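/- arXiv:math/0504432 — 5 statements merged into one kernel-verified Lean document; each statement's English description precedes it below -/
import Mathlib

section
/- Let A be a commutative ring, let t ∈ A, and let C denote the cokernel of the canonical A-module map from A to the localization A[1/t] of A away from t. For k ≥ 0 let ξ_k ∈ C denote the class of 1/t^k, and for an A-module M let M[t^k] := {m ∈ M : t^k·m = 0}. Then for every A-module M, the map sending an A-module homomorphism φ : C → M to the sequence (φ(ξ_k))_{k≥0} is a well-defined A-module isomorphism from Hom_A(C, M) onto the inverse limit lim_k M[t^k], taken along the transition maps M[t^{k+1}] → M[t^k] given by m ↦ t·m. -/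
variable (A : Type*) [CommRing A]

/-- The cokernel `A[1/t]/A` of the canonical map from `A` to the localization of `A`
away from `t`. -/
abbrev LocModA (t : A) : Type _ :=
  Localization.Away t ⧸ LinearMap.range (Algebra.linearMap A (Localization.Away t))

/-- The class `ξ_k` of `1/t^k` in `A[1/t]/A`. -/
def xiClass (t : A) (k : ℕ) : LocModA A t :=
  Submodule.Quotient.mk (Localization.mk 1 ⟨t ^ k, k, rfl⟩)

variable (M : Type*) [AddCommGroup M] [Module A M]

/-- The inverse limit `lim_k M[t^k]`, realized as the submodule of `ℕ → M`
consisting of sequences `m` with `t^k • m k = 0` and `t • m (k+1) = m k`. -/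
def torsionInverseLimit (t : A) : Submodule A (ℕ → M) where
  carrier := {m | (∀ k, t ^ k • m k = 0) ∧ ∀ k, t • m (k + 1) = m k}
  add_mem' := by
    rintro a b ⟨ha1, ha2⟩ ⟨hb1, hb2⟩
    refine ⟨fun k => ?_, fun k => ?_⟩
    · simp [smul_add, ha1 k, hb1 k]
    · simp [smul_add, ha2 k, hb2 k]
  zero_mem' := by
    refine ⟨fun k => ?_, fun k => ?_⟩ <;> simp
  smul_mem' := by
    rintro c m ⟨h1, h2⟩
    refine ⟨fun k => ?_, fun k => ?_⟩
    · rw [Pi.smul_apply, smul_comm, h1 k, smul_zero]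
    · rw [Pi.smul_apply, Pi.smul_apply, smul_comm, h2 k]

section TorsionSequences

variable {A M} {t : A} {m : ℕ → M}

theorem pow_smul_apply_add_of_mem_torsionInverseLimit (hm : m ∈ torsionInverseLimit A M t)
    (k n : ℕ) : t ^ n • m (k + n) = m k := by
  induction n with
  | zero => simp
  | succ n ih => rw [pow_succ, mul_smul, ← add_assoc, hm.2, ih]

theorem smul_apply_eq_of_mk_eq (hm : m ∈ torsionInverseLimit A M t) {a b : A} {k l : ℕ}
    (h : Localization.mk a (⟨t ^ k, k, rfl⟩ : Submonoid.powers t) =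
      Localization.mk b (⟨t ^ l, l, rfl⟩ : Submonoid.powers t)) : a • m k = b • m l := by
  obtain ⟨⟨_, n, rfl⟩, hn⟩ := Localization.r_iff_exists.mp (Localization.mk_eq_mk_iff.mp h)
  replace hn : t ^ n * (t ^ l * a) = t ^ n * (t ^ k * b) := hn
  have hk := pow_smul_apply_add_of_mem_torsionInverseLimit hm k (l + n)
  have hl := pow_smul_apply_add_of_mem_torsionInverseLimit hm l (k + n)
  rw [← hk, ← hl, smul_smul, smul_smul, show l + (k + n) = k + (l + n) by omega]
  congr 1
  linear_combination hn

theorem exists_mk_pow_eq (x : Localization.Away t) :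
    ∃ (a : A) (k : ℕ), Localization.mk a (⟨t ^ k, k, rfl⟩ : Submonoid.powers t) = x := by
  induction x using Localization.induction_on with
  | H y =>
    obtain ⟨a, _, k, rfl⟩ := y
    exact ⟨a, k, rfl⟩

theorem smul_xiClass (a : A) (k : ℕ) :
    a • xiClass A t k = Submodule.Quotient.mk
      (Localization.mk a (⟨t ^ k, k, rfl⟩ : Submonoid.powers t)) := by
  rw [xiClass, ← Submodule.Quotient.mk_smul, Localization.smul_mk, smul_eq_mul, mul_one]

theorem pow_smul_xiClass (k : ℕ) : t ^ k • xiClass A t k = 0 := by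
  rw [smul_xiClass, Submodule.Quotient.mk_eq_zero]
  refine ⟨1, ?_⟩
  rw [Algebra.linearMap_apply, map_one,
    ← Localization.mk_self (⟨t ^ k, k, rfl⟩ : Submonoid.powers t)]

theorem smul_xiClass_succ (k : ℕ) : t • xiClass A t (k + 1) = xiClass A t k := by
  rw [smul_xiClass, xiClass]
  congr 1
  rw [Localization.mk_eq_mk_iff, Localization.r_iff_exists]
  refine ⟨1, ?_⟩
  change 1 * (t ^ k * t) = 1 * (t ^ (k + 1) * 1)
  ring

theorem exists_linearMap_localizationAway (hm : m ∈ torsionInverseLimit A M t) :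
    ∃ f : Localization.Away t →ₗ[A] M,
      ∀ (a : A) (k : ℕ),
        f (Localization.mk a (⟨t ^ k, k, rfl⟩ : Submonoid.powers t)) = a • m k := by
  choose a k hak using exists_mk_pow_eq (t := t)
  have key (x : Localization.Away t) (b : A) (l : ℕ)
      (h : Localization.mk b (⟨t ^ l, l, rfl⟩ : Submonoid.powers t) = x) :
      a x • m (k x) = b • m l :=
    smul_apply_eq_of_mk_eq hm ((hak x).trans h.symm)
  refine ⟨{ toFun := fun x => a x • m (k x), map_add' := fun x y => ?_,
            map_smul' := fun c x => ?_ }, fun b l => key _ b l rfl⟩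
  · rw [key (x + y) (t ^ k x * a y + t ^ k y * a x) (k x + k y), add_smul, mul_comm, mul_smul,
      mul_comm, mul_smul, add_comm (k x), pow_smul_apply_add_of_mem_torsionInverseLimit hm,
      add_comm (k y), pow_smul_apply_add_of_mem_torsionInverseLimit hm, add_comm]
    conv_rhs => rw [← hak x, ← hak y, Localization.add_mk]
    congr 1
    exact Subtype.ext (pow_add t _ _)
  · rw [key (c • x) (c * a x) (k x), mul_smul, RingHom.id_apply]
    conv_rhs => rw [← hak x, Localization.smul_mk, smul_eq_mul]

theorem exists_linearMap_apply_xiClass (hm : m ∈ torsionInverseLimit A M t) :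
    ∃ φ : LocModA A t →ₗ[A] M, ∀ k, φ (xiClass A t k) = m k := by
  obtain ⟨f, hf⟩ := exists_linearMap_localizationAway hm
  refine ⟨Submodule.liftQ _ f ?_, fun k => ?_⟩
  · rintro _ ⟨a, rfl⟩
    have h0 : m 0 = 0 := by simpa using hm.1 0
    have h := hf a 0
    rw [h0, smul_zero] at h
    rw [LinearMap.mem_ker, Algebra.linearMap_apply, ← Localization.mk_algebraMap]
    have h1 : (⟨t ^ 0, 0, rfl⟩ : Submonoid.powers t) = 1 := Subtype.ext (pow_zero t)
    rwa [h1] at h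
  · rw [xiClass, Submodule.liftQ_apply, hf, one_smul]

variable (A M t) in
/-- Evaluation of a homomorphism `A[1/t]/A → M` at the classes `ξ_k`. -/
def evalXiClass : (LocModA A t →ₗ[A] M) →ₗ[A] torsionInverseLimit A M t where
  toFun φ := ⟨fun k => φ (xiClass A t k),
    fun k => by rw [← map_smul, pow_smul_xiClass, map_zero],
    fun k => by rw [← map_smul, smul_xiClass_succ]⟩
  map_add' _ _ := rfl
  map_smul' _ _ := rfl

theorem evalXiClass_injective : Function.Injective (evalXiClass A M t) := by
  intro φ ψ h
  ext x
  obtain ⟨a, k, rfl⟩ := exists_mk_pow_eq x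
  have hk : φ (xiClass A t k) = ψ (xiClass A t k) := congrFun (congrArg Subtype.val h) k
  change φ (Submodule.Quotient.mk _) = ψ (Submodule.Quotient.mk _)
  rw [← smul_xiClass, map_smul, map_smul, hk]

theorem evalXiClass_surjective : Function.Surjective (evalXiClass A M t) := by
  rintro ⟨m, hm⟩
  obtain ⟨φ, hφ⟩ := exists_linearMap_apply_xiClass hm
  exact ⟨φ, Subtype.ext (funext hφ)⟩

end TorsionSequences

/-- For a commutative ring `A`, `t ∈ A`, and an `A`-module `M`, the map
`φ ↦ (φ ξ_k)_k` is an `A`-module isomorphism from `Hom_A(A[1/t]/A, M)` onto the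
inverse limit `lim_k M[t^k]` along multiplication by `t`. -/
theorem homFromLocalizationCokernel_equiv_inverseLimit (t : A) :
    ∃ e : (LocModA A t →ₗ[A] M) ≃ₗ[A] torsionInverseLimit A M t,
      ∀ (φ : LocModA A t →ₗ[A] M) (k : ℕ), (e φ : ℕ → M) k = φ (xiClass A t k) := by
  exact ⟨LinearEquiv.ofBijective (evalXiClass A M t)
    ⟨evalXiClass_injective, evalXiClass_surjective⟩, fun _ _ => rfl⟩
end

section
/- With R, t_F, V, (T_s) and the idempotent pieces as defined in the context, let (φ_s)_{s≥1} be a family of maps φ_s : ℚ[c,c⁻¹] ⊗_ℚ V → T_s, each linear over ℚ[c] (acting through the first tensor factor on the source), such that for every v ∈ V one has φ_s(1 ⊗ v) = 0 for all but finitely many s. Then there exists a unique R-linear map q : t_F ⊗_ℚ V → ⊕_{s≥1} T_s whose s-th idempotent piece equals φ_s for every s ≥ 1. -/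
open LaurentPolynomial
open scoped TensorProduct

abbrev PiPoly : Type := ∀ _ : ℕ+, Polynomial ℚ
abbrev PiLaurent : Type := ∀ _ : ℕ+, LaurentPolynomial ℚ

noncomputable def tF : Submodule PiPoly PiLaurent where
  carrier := {f | {s | f s ∉ Set.range (Polynomial.toLaurent (R := ℚ))}.Finite}
  zero_mem' := Set.finite_empty.subset (by
    intro s hs
    exact hs ⟨0, map_zero _⟩)
  add_mem' := by
    intro a b ha hb
    refine (ha.union hb).subset ?_
    intro s hs
    simp only [Set.mem_union, Set.mem_setOf_eq]
    by_contra h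
    push_neg at h
    obtain ⟨⟨p, hp⟩, ⟨q, hq⟩⟩ := h
    exact hs ⟨p + q, by rw [map_add, hp, hq]; rfl⟩
  smul_mem' := by
    intro r f hf
    refine hf.subset ?_
    intro s hs
    simp only [Set.mem_setOf_eq] at hs ⊢
    intro hmem
    obtain ⟨q, hq⟩ := hmem
    refine hs ⟨r s * q, ?_⟩
    rw [map_mul, hq, Pi.smul_apply', Algebra.smul_def, algebraMap_eq_toLaurent]

/-- `ι_s : ℚ[c,c⁻¹] → t_F`, placing a Laurent polynomial in the `s`-th slot and `0`
in all other slots. -/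
noncomputable def iotaS (s : ℕ+) : LaurentPolynomial ℚ →ₗ[ℚ] tF where
  toFun x := ⟨Pi.single s x, (Set.finite_singleton s).subset (by
    intro s' hs'
    simp only [Set.mem_setOf_eq] at hs'
    by_contra hne
    refine hs' ?_
    rw [Pi.single_eq_of_ne (by simpa using hne)]
    exact ⟨0, map_zero _⟩)⟩
  map_add' x y := Subtype.ext (by simp [Pi.single_add])
  map_smul' q x := Subtype.ext (by simp [Pi.single_smul])

/-- The `R`-module structure on each `ℚ[c]`-module `T s`, with `R = ∏_{s≥1} ℚ[c]`
acting through the `s`-th projection. -/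
noncomputable instance piPolyModule (T : ℕ+ → Type*) [∀ s, AddCommGroup (T s)]
    [∀ s, Module (Polynomial ℚ) (T s)] (s : ℕ+) : Module PiPoly (T s) :=
  Module.compHom (T s) (Pi.evalRingHom (fun _ => Polynomial ℚ) s)

noncomputable example (T : ℕ+ → Type*) [∀ s, AddCommGroup (T s)]
    [∀ s, Module (Polynomial ℚ) (T s)] : Module PiPoly (Π₀ s, T s) := inferInstance

/-- The `s`-th idempotent piece of an `R`-linear map `q : t_F ⊗_ℚ V → ⊕_s T_s`,
namely the composite of `ι_s ⊗ id` with `q` and the projection to `T s`. -/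
noncomputable def idempotentPiece {V : Type*} [AddCommGroup V] [Module ℚ V]
    {T : ℕ+ → Type*} [∀ s, AddCommGroup (T s)] [∀ s, Module (Polynomial ℚ) (T s)]
    (q : tF ⊗[ℚ] V →ₗ[PiPoly] Π₀ s, T s) (s : ℕ+) :
    LaurentPolynomial ℚ ⊗[ℚ] V → T s :=
  fun x => q (TensorProduct.map (iotaS s) LinearMap.id x) s

/-- The projection of `t_F` onto its `s`-th slot. -/
noncomputable def projS (s : ℕ+) : tF →ₗ[ℚ] LaurentPolynomial ℚ where
  toFun f := f.1 s
  map_add' _ _ := rfl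
  map_smul' _ _ := rfl

section

variable {V : Type*} [AddCommGroup V] [Module ℚ V]

theorem map_projS_smul (s : ℕ+) (r : PiPoly) (x : tF ⊗[ℚ] V) :
    TensorProduct.map (projS s) LinearMap.id (r • x) =
      r s • TensorProduct.map (projS s) LinearMap.id x := by
  induction x with
  | zero => simp
  | add x y hx hy => rw [smul_add, map_add, map_add, smul_add, hx, hy]
  | tmul f v => rfl

theorem map_projS_map_iotaS (s : ℕ+) (x : LaurentPolynomial ℚ ⊗[ℚ] V) :
    TensorProduct.map (projS s) LinearMap.id (TensorProduct.map (iotaS s) LinearMap.id x) = x := by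
  induction x with
  | zero => simp
  | add x y hx hy => rw [map_add, map_add, hx, hy]
  | tmul f v =>
    simp only [TensorProduct.map_tmul, LinearMap.id_apply]
    congr 1
    exact Pi.single_eq_same (M := fun _ : ℕ+ => LaurentPolynomial ℚ) s f

theorem map_iotaS_map_projS (s : ℕ+) (x : tF ⊗[ℚ] V) :
    TensorProduct.map (iotaS s) LinearMap.id (TensorProduct.map (projS s) LinearMap.id x) =
      (Pi.single s 1 : PiPoly) • x := by
  induction x with
  | zero => simp
  | add x y hx hy => rw [map_add, map_add, smul_add, hx, hy]
  | tmul f v =>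
    rw [TensorProduct.smul_tmul']
    simp only [TensorProduct.map_tmul, LinearMap.id_apply]
    congr 1
    refine Subtype.ext (funext fun t => ?_)
    change (Pi.single s (f.1 s) : PiLaurent) t = (Pi.single s 1 : PiPoly) t • f.1 t
    obtain rfl | h := eq_or_ne t s
    · simp
    · simp [Pi.single_eq_of_ne h]

variable {T : ℕ+ → Type*} [∀ s, AddCommGroup (T s)] [∀ s, Module (Polynomial ℚ) (T s)]

theorem apply_eq_idempotentPiece (q : tF ⊗[ℚ] V →ₗ[PiPoly] Π₀ s, T s) (s : ℕ+)
    (x : tF ⊗[ℚ] V) :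
    q x s = idempotentPiece q s (TensorProduct.map (projS s) LinearMap.id x) := by
  rw [idempotentPiece, map_iotaS_map_projS, map_smul]
  change q x s = (Pi.single s 1 : PiPoly) s • q x s
  rw [Pi.single_eq_same, one_smul]

theorem finite_setOf_apply_map_projS_ne_zero
    (φ : ∀ s : ℕ+, LaurentPolynomial ℚ ⊗[ℚ] V →ₗ[Polynomial ℚ] T s)
    (hφ : ∀ v : V, {s : ℕ+ | φ s ((1 : LaurentPolynomial ℚ) ⊗ₜ[ℚ] v) ≠ 0}.Finite)
    (x : tF ⊗[ℚ] V) :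
    {s : ℕ+ | φ s (TensorProduct.map (projS s) LinearMap.id x) ≠ 0}.Finite := by
  induction x with
  | zero => simp
  | add x y hx hy =>
    refine (hx.union hy).subset fun s hs => ?_
    by_contra h
    simp only [Set.mem_union, Set.mem_ofPred_eq, not_or, not_not] at h
    exact hs (by rw [map_add, map_add, h.1, h.2, add_zero])
  | tmul f v =>
    refine (f.2.union (hφ v)).subset fun s hs => ?_
    by_contra h
    simp only [Set.mem_union, Set.mem_ofPred_eq, not_or, not_not] at h
    obtain ⟨⟨p, hp⟩, h1⟩ := h
    have hf : projS s f = p • (1 : LaurentPolynomial ℚ) := by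
      rw [Algebra.smul_def, mul_one, algebraMap_eq_toLaurent, hp]
      rfl
    refine hs ?_
    rw [TensorProduct.map_tmul, LinearMap.id_apply, hf, ← TensorProduct.smul_tmul', map_smul, h1,
      smul_zero]

open Classical in
/-- The `R`-linear map `t_F ⊗_ℚ V → ⊕_s T_s` assembled from its idempotent pieces. -/
noncomputable def ofIdempotentPieces
    (φ : ∀ s : ℕ+, LaurentPolynomial ℚ ⊗[ℚ] V →ₗ[Polynomial ℚ] T s)
    (hφ : ∀ v : V, {s : ℕ+ | φ s ((1 : LaurentPolynomial ℚ) ⊗ₜ[ℚ] v) ≠ 0}.Finite) :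
    tF ⊗[ℚ] V →ₗ[PiPoly] Π₀ s, T s :=
  have apply_mk (x : tF ⊗[ℚ] V) (s : ℕ+) :
      DFinsupp.mk (finite_setOf_apply_map_projS_ne_zero φ hφ x).toFinset
        (fun t => φ t (TensorProduct.map (projS t.1) LinearMap.id x)) s =
      φ s (TensorProduct.map (projS s) LinearMap.id x) := by
    simp +contextual [DFinsupp.mk_apply, eq_comm]
  { toFun x := DFinsupp.mk (finite_setOf_apply_map_projS_ne_zero φ hφ x).toFinset
      fun t => φ t (TensorProduct.map (projS t.1) LinearMap.id x)
    map_add' x y := by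
      ext s
      rw [DFinsupp.add_apply, apply_mk, apply_mk, apply_mk, map_add, map_add]
    map_smul' r x := by
      ext s
      rw [RingHom.id_apply, DFinsupp.smul_apply, apply_mk, apply_mk, map_projS_smul, map_smul]
      rfl }

theorem ofIdempotentPieces_apply
    (φ : ∀ s : ℕ+, LaurentPolynomial ℚ ⊗[ℚ] V →ₗ[Polynomial ℚ] T s)
    (hφ : ∀ v : V, {s : ℕ+ | φ s ((1 : LaurentPolynomial ℚ) ⊗ₜ[ℚ] v) ≠ 0}.Finite)
    (x : tF ⊗[ℚ] V) (s : ℕ+) :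
    ofIdempotentPieces φ hφ x s = φ s (TensorProduct.map (projS s) LinearMap.id x) := by
  classical
  simp +contextual [ofIdempotentPieces, DFinsupp.mk_apply, eq_comm]

end

/-- Given a family of `ℚ[c]`-linear maps `φ_s : ℚ[c,c⁻¹] ⊗_ℚ V → T_s` such that for
every `v ∈ V` one has `φ_s (1 ⊗ v) = 0` for all but finitely many `s`, there is a
unique `R`-linear map `q : t_F ⊗_ℚ V → ⊕_{s≥1} T_s` whose `s`-th idempotent piece
is `φ_s` for every `s`. -/
theorem exists_unique_linearMap_of_idempotentPieces {V : Type*} [AddCommGroup V]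
    [Module ℚ V] {T : ℕ+ → Type*} [∀ s, AddCommGroup (T s)]
    [∀ s, Module (Polynomial ℚ) (T s)]
    (φ : ∀ s : ℕ+, LaurentPolynomial ℚ ⊗[ℚ] V →ₗ[Polynomial ℚ] T s)
    (hφ : ∀ v : V, {s : ℕ+ | φ s ((1 : LaurentPolynomial ℚ) ⊗ₜ[ℚ] v) ≠ 0}.Finite) :
    ∃! q : tF ⊗[ℚ] V →ₗ[PiPoly] Π₀ s, T s,
      ∀ s : ℕ+, idempotentPiece q s = ⇑(φ s) := by
  refine ⟨ofIdempotentPieces φ hφ, fun s => funext fun x => ?_, fun q hq => ?_⟩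
  · rw [idempotentPiece, ofIdempotentPieces_apply, map_projS_map_iotaS]
  · refine LinearMap.ext fun x => DFinsupp.ext fun s => ?_
    rw [apply_eq_idempotentPiece, hq, ofIdempotentPieces_apply]
end

section
/- Let R := ∏_{s≥1} ℚ[c], and for a finite set π of positive integers let R(π) ⊆ ∏_{s≥1} ℚ[c,c⁻¹] be the R-submodule of sequences (f_s) with f_s ∈ ℚ[c] for every s ∉ π, i.e. R(π) = ∏_{s∈π} ℚ[c,c⁻¹] × ∏_{s∉π} ℚ[c]. Then for every R-module N and all finite sets π, π′ of positive integers, the sequence 0 → N ⊗_R R(π∩π′) → (N ⊗_R R(π)) ⊕ (N ⊗_R R(π′)) → N ⊗_R R(π∪π′) → 0 is exact, where the first map is induced by the inclusions R(π∩π′) ⊆ R(π) and R(π∩π′) ⊆ R(π′), and the second map is the difference of the maps induced by the inclusions R(π) ⊆ R(π∪π′) and R(π′) ⊆ R(π∪π′). -/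
set_option synthInstance.maxHeartbeats 1000000
set_option maxHeartbeats 1000000

open LaurentPolynomial
open scoped TensorProduct

/-- For a finite set `π` of positive integers, the `R`-submodule
`R(π) = ∏_{s∈π} ℚ[c,c⁻¹] × ∏_{s∉π} ℚ[c]` of `∏_{s≥1} ℚ[c,c⁻¹]`, consisting of
sequences whose entries away from `π` are polynomials in `c`. -/
noncomputable def Rpi (π : Finset ℕ+) : Submodule PiPoly PiLaurent where
  carrier := {f | ∀ s ∉ π, f s ∈ Set.range (Polynomial.toLaurent (R := ℚ))}
  zero_mem' := fun s _ => ⟨0, map_zero _⟩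
  add_mem' := by
    intro a b ha hb s hs
    obtain ⟨p, hp⟩ := ha s hs
    obtain ⟨q, hq⟩ := hb s hs
    exact ⟨p + q, by rw [map_add, hp, hq]; rfl⟩
  smul_mem' := by
    intro r f hf s hs
    obtain ⟨q, hq⟩ := hf s hs
    refine ⟨r s * q, ?_⟩
    rw [map_mul, hq, Pi.smul_apply', Algebra.smul_def, algebraMap_eq_toLaurent]

theorem Rpi_mono {π π' : Finset ℕ+} (h : π ⊆ π') : Rpi π ≤ Rpi π' :=
  fun _ hf s hs => hf s fun hmem => hs (h hmem)

open scoped TensorProduct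

variable (N : Type*) [AddCommGroup N] [Module PiPoly N]

/-- The map `N ⊗ R(π∩π′) → (N ⊗ R(π)) ⊕ (N ⊗ R(π′))` induced by the inclusions. -/
noncomputable def mvInto (π π' : Finset ℕ+) :
    N ⊗[PiPoly] Rpi (π ∩ π') →ₗ[PiPoly]
      (N ⊗[PiPoly] Rpi π) × (N ⊗[PiPoly] Rpi π') :=
  LinearMap.prod
    (LinearMap.lTensor N (Submodule.inclusion (Rpi_mono Finset.inter_subset_left)))
    (LinearMap.lTensor N (Submodule.inclusion (Rpi_mono Finset.inter_subset_right)))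

/-- The map `(N ⊗ R(π)) ⊕ (N ⊗ R(π′)) → N ⊗ R(π∪π′)` given by the difference of
the maps induced by the two inclusions (the second summand is tensored with the
negative of the inclusion, i.e. `N ⊗ (−incl) = −(N ⊗ incl)`). -/
noncomputable def mvOut (π π' : Finset ℕ+) :
    (N ⊗[PiPoly] Rpi π) × (N ⊗[PiPoly] Rpi π') →ₗ[PiPoly]
      N ⊗[PiPoly] Rpi (π ∪ π') :=
  LinearMap.coprod
    (LinearMap.lTensor N (Submodule.inclusion
      (Rpi_mono (Finset.subset_union_left (s₁ := π) (s₂ := π')))))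
    (LinearMap.lTensor N (-(Submodule.inclusion
      (Rpi_mono (Finset.subset_union_right (s₁ := π) (s₂ := π'))))))

theorem lTensor_injective_exact_surjective_of_split
    {R M I P Q U : Type*} [CommRing R] [AddCommGroup M] [Module R M]
    [AddCommGroup I] [Module R I] [AddCommGroup P] [Module R P]
    [AddCommGroup Q] [Module R Q] [AddCommGroup U] [Module R U]
    {i₁ : I →ₗ[R] P} {i₂ : I →ₗ[R] Q} {j₁ : P →ₗ[R] U} {j₂ : Q →ₗ[R] U}
    (r₁ : P →ₗ[R] I) (r₂ : Q →ₗ[R] I) (u : U →ₗ[R] P) (v : U →ₗ[R] Q)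
    (hI : r₁ ∘ₗ i₁ + r₂ ∘ₗ i₂ = LinearMap.id)
    (hU : j₁ ∘ₗ u + j₂ ∘ₗ v = LinearMap.id)
    (hP : i₁ ∘ₗ r₁ + u ∘ₗ j₁ = LinearMap.id)
    (hPQ : i₁ ∘ₗ r₂ + u ∘ₗ j₂ = 0)
    (hQP : i₂ ∘ₗ r₁ + v ∘ₗ j₁ = 0)
    (hQ : i₂ ∘ₗ r₂ + v ∘ₗ j₂ = LinearMap.id)
    (hz : j₁ ∘ₗ i₁ + j₂ ∘ₗ i₂ = 0) :
    Function.Injective ((i₁.lTensor M).prod (i₂.lTensor M)) ∧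
    Function.Exact ((i₁.lTensor M).prod (i₂.lTensor M))
      ((j₁.lTensor M).coprod (j₂.lTensor M)) ∧
    Function.Surjective ((j₁.lTensor M).coprod (j₂.lTensor M)) := by
  replace hI := congrArg (LinearMap.lTensor M) hI
  replace hU := congrArg (LinearMap.lTensor M) hU
  replace hP := congrArg (LinearMap.lTensor M) hP
  replace hPQ := congrArg (LinearMap.lTensor M) hPQ
  replace hQP := congrArg (LinearMap.lTensor M) hQP
  replace hQ := congrArg (LinearMap.lTensor M) hQ
  replace hz := congrArg (LinearMap.lTensor M) hz
  simp only [LinearMap.lTensor_add, LinearMap.lTensor_comp, LinearMap.lTensor_id,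
    LinearMap.lTensor_zero, LinearMap.ext_iff, LinearMap.add_apply, LinearMap.comp_apply,
    LinearMap.id_apply, LinearMap.zero_apply] at hI hU hP hPQ hQP hQ hz
  refine ⟨?_, ?_, fun x => ⟨(u.lTensor M x, v.lTensor M x), hU x⟩⟩
  · refine Function.LeftInverse.injective
      (g := (r₁.lTensor M).coprod (r₂.lTensor M)) fun x => hI x
  · rintro ⟨x, y⟩
    constructor
    · intro h
      replace h : j₁.lTensor M x + j₂.lTensor M y = 0 := h
      have hu := congrArg (u.lTensor M) h
      have hv := congrArg (v.lTensor M) h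
      rw [map_add, map_zero] at hu hv
      refine ⟨r₁.lTensor M x + r₂.lTensor M y, Prod.ext ?_ ?_⟩
      · change i₁.lTensor M _ = x
        rw [map_add]
        linear_combination (norm := module) hP x + hPQ y - hu
      · change i₂.lTensor M _ = y
        rw [map_add]
        linear_combination (norm := module) hQP x + hQ y - hv
    · rintro ⟨z, hz'⟩
      rw [← hz']
      exact hz z

/-- The idempotent of `PiPoly` supported on `π`. -/
noncomputable def piIndicator (π : Finset ℕ+) : PiPoly := fun s => if s ∈ π then 1 else 0

/-- Multiplication by an element of `PiPoly`, as a map between two of the modules `Rpi`. -/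
noncomputable def rpiSMul (e : PiPoly) {σ τ : Finset ℕ+} (h : ∀ f ∈ Rpi σ, e • f ∈ Rpi τ) :
    Rpi σ →ₗ[PiPoly] Rpi τ :=
  (LinearMap.lsmul PiPoly PiLaurent e).restrict h

theorem coe_rpiSMul (e : PiPoly) {σ τ : Finset ℕ+} (h : ∀ f ∈ Rpi σ, e • f ∈ Rpi τ)
    (f : Rpi σ) : (rpiSMul e h f : PiLaurent) = e • (f : PiLaurent) := rfl

theorem smul_mem_Rpi {e : PiPoly} {σ τ : Finset ℕ+} (h : ∀ s ∈ σ, s ∉ τ → e s = 0)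
    {f : PiLaurent} (hf : f ∈ Rpi σ) : e • f ∈ Rpi τ := by
  intro s hs
  by_cases hσ : s ∈ σ
  · exact ⟨0, by rw [map_zero, Pi.smul_apply', h s hσ hs, zero_smul]⟩
  · exact (Rpi σ).smul_mem e hf s hσ

/-- The Mayer–Vietoris sequence
`0 → N ⊗ R(π∩π′) → (N ⊗ R(π)) ⊕ (N ⊗ R(π′)) → N ⊗ R(π∪π′) → 0` is exact for every
`R`-module `N` and all finite sets `π`, `π′` of positive integers. -/
theorem mayerVietoris_exact (π π' : Finset ℕ+) :
    Function.Injective (mvInto N π π') ∧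
    Function.Exact (mvInto N π π') (mvOut N π π') ∧
    Function.Surjective (mvOut N π π') := by
  classical
  have hA (ρ : Finset ℕ+) (s : ℕ+) :
      (s ∈ ρ ∧ piIndicator ρ s = 1) ∨ (s ∉ ρ ∧ piIndicator ρ s = 0) := by
    by_cases h : s ∈ ρ <;> simp [piIndicator, h]
  refine lTensor_injective_exact_surjective_of_split
    (rpiSMul (1 - piIndicator π) fun f => smul_mem_Rpi fun s h₁ h₂ => ?_)
    (rpiSMul (piIndicator π) fun f => smul_mem_Rpi fun s h₁ h₂ => ?_)
    (rpiSMul (piIndicator π) fun f => smul_mem_Rpi fun s h₁ h₂ => ?_)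
    (rpiSMul (-(1 - piIndicator π)) fun f => smul_mem_Rpi fun s h₁ h₂ => ?_)
    ?_ ?_ ?_ ?_ ?_ ?_ ?_
  iterate 4
    rcases hA π s with ⟨h, h'⟩ | ⟨h, h'⟩ <;> simp_all
  all_goals
    refine LinearMap.ext fun f => Subtype.ext ?_
    simp only [LinearMap.add_apply, LinearMap.comp_apply, LinearMap.neg_apply,
      LinearMap.id_apply, LinearMap.zero_apply, Submodule.coe_add, Submodule.coe_neg,
      Submodule.coe_zero, Submodule.coe_inclusion, coe_rpiSMul]
    module
end

section
/- Let R := ℚ[X,Y]/(X²+Y²−1), and let x and y denote the images of X and Y in R. Then the ideal of R generated by 1−x and y is not a principal ideal. -/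
open MvPolynomial

/-- The coordinate ring of the non-split one-dimensional torus over `ℚ`. -/
noncomputable abbrev NonSplitTorus : Type :=
  MvPolynomial (Fin 2) ℚ ⧸ Ideal.span {(X 0 : MvPolynomial (Fin 2) ℚ) ^ 2 + X 1 ^ 2 - 1}

/-- The image of `X` in `ℚ[X,Y]/(X²+Y²−1)`. -/
noncomputable def NonSplitTorus.x : NonSplitTorus := Ideal.Quotient.mk _ (X 0)

/-- The image of `Y` in `ℚ[X,Y]/(X²+Y²−1)`. -/
noncomputable def NonSplitTorus.y : NonSplitTorus := Ideal.Quotient.mk _ (X 1)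

/-- The coordinate ring of the non-split torus, presented as `ℚ[t][√(1 - t²)]`. -/
abbrev TorusQuadraticAlgebra : Type :=
  QuadraticAlgebra (Polynomial ℚ) (1 - Polynomial.X ^ 2) 0

namespace NonSplitTorus

/-- The homomorphism `ℚ[X,Y]/(X²+Y²−1) → ℚ[t][√(1 - t²)]` sending `x` to `t` and `y` to
`√(1 - t²)`. -/
noncomputable def toQuadraticAlgebra : NonSplitTorus →+* TorusQuadraticAlgebra :=
  Ideal.Quotient.lift _
    (MvPolynomial.eval₂Hom (algebraMap ℚ TorusQuadraticAlgebra)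
      ![⟨Polynomial.X, 0⟩, ⟨0, 1⟩])
    (by
      intro p hp
      rw [← RingHom.mem_ker]
      refine (Ideal.span_singleton_le_iff_mem _).2 ?_ hp
      rw [RingHom.mem_ker]
      ext1 <;> simp [pow_two, QuadraticAlgebra.re_one, QuadraticAlgebra.im_one])

@[simp]
theorem toQuadraticAlgebra_x : toQuadraticAlgebra x = ⟨Polynomial.X, 0⟩ := by
  simp [toQuadraticAlgebra, x]

@[simp]
theorem toQuadraticAlgebra_y : toQuadraticAlgebra y = ⟨0, 1⟩ := by
  simp [toQuadraticAlgebra, y]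

end NonSplitTorus

/-- The polynomial `(1 - t) a² - (1 + t) b²` is nonnegative at `-1` and nonpositive at `1`, so it
is not a nonzero constant. -/
theorem Polynomial.not_isUnit_one_sub_X_mul_sq_sub (a b : Polynomial ℚ) :
    ¬ IsUnit ((1 - Polynomial.X) * a ^ 2 - (1 + Polynomial.X) * b ^ 2) := by
  intro h
  obtain ⟨c, hc, h⟩ := Polynomial.isUnit_iff.1 h
  have h1 := congrArg (Polynomial.eval 1) h
  have h2 := congrArg (Polynomial.eval (-1)) h
  simp only [Polynomial.eval_C, Polynomial.eval_sub, Polynomial.eval_mul, Polynomial.eval_add,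
    Polynomial.eval_one, Polynomial.eval_X, Polynomial.eval_pow] at h1 h2
  apply hc.ne_zero
  nlinarith [sq_nonneg (b.eval 1), sq_nonneg (a.eval (-1))]

/-- In `R = ℚ[X,Y]/(X²+Y²−1)`, the ideal generated by `1 − x` and `y` is not
principal. -/
theorem nonSplitTorus_ideal_not_principal :
    ¬ (Ideal.span {1 - NonSplitTorus.x, NonSplitTorus.y}).IsPrincipal := by
  rintro ⟨g, hg⟩
  rw [Ideal.submodule_span_eq] at hg
  have hgx : g ∣ 1 - NonSplitTorus.x := by
    rw [← Ideal.mem_span_singleton, ← hg]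
    exact Ideal.subset_span (by simp)
  have hgy : g ∣ NonSplitTorus.y := by
    rw [← Ideal.mem_span_singleton, ← hg]
    exact Ideal.subset_span (by simp)
  obtain ⟨u, v, huv⟩ := Ideal.mem_span_pair.1 (hg ▸ Ideal.mem_span_singleton_self g)
  set q := NonSplitTorus.toQuadraticAlgebra g with hq
  have hnx := map_dvd QuadraticAlgebra.norm (map_dvd NonSplitTorus.toQuadraticAlgebra hgx)
  have hny := map_dvd QuadraticAlgebra.norm (map_dvd NonSplitTorus.toQuadraticAlgebra hgy)
  rw [map_sub, map_one, NonSplitTorus.toQuadraticAlgebra_x, ← hq] at hnx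
  rw [NonSplitTorus.toQuadraticAlgebra_y, ← hq] at hny
  simp only [QuadraticAlgebra.norm_def, QuadraticAlgebra.re_sub, QuadraticAlgebra.im_sub,
    QuadraticAlgebra.re_one, QuadraticAlgebra.im_one] at hnx hny
  have hre : (1 - Polynomial.X : Polynomial ℚ) ∣ q.re := by
    rw [hq, ← huv]
    simp only [map_add, map_mul, map_sub, map_one, NonSplitTorus.toQuadraticAlgebra_x,
      NonSplitTorus.toQuadraticAlgebra_y, QuadraticAlgebra.re_add, QuadraticAlgebra.re_mul,
      QuadraticAlgebra.re_sub, QuadraticAlgebra.im_sub, QuadraticAlgebra.re_one,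
      QuadraticAlgebra.im_one]
    exact ⟨(NonSplitTorus.toQuadraticAlgebra u).re +
      (1 + Polynomial.X) * (NonSplitTorus.toQuadraticAlgebra v).im, by ring⟩
  obtain ⟨a, ha⟩ := hre
  rw [ha] at hnx hny
  have hX : (1 - Polynomial.X : Polynomial ℚ) ≠ 0 := fun h => by
    simpa using congrArg (Polynomial.eval 0) h
  refine Polynomial.not_isUnit_one_sub_X_mul_sq_sub a q.im (isUnit_iff_dvd_one.2 ?_)
  refine (mul_dvd_mul_iff_left hX).1 ?_
  have h2 : (1 - Polynomial.X : Polynomial ℚ) * 1 =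
      Polynomial.C (1 / 2) * ((1 - Polynomial.X) ^ 2 + (1 - Polynomial.X ^ 2)) := by
    have hC : Polynomial.C (1 / 2 : ℚ) * 2 = 1 := by
      rw [← Polynomial.C_ofNat, ← Polynomial.C_mul]; norm_num
    linear_combination (Polynomial.X - 1) * hC
  rw [h2]
  refine Dvd.dvd.mul_left (dvd_add ?_ ?_) _
  · convert hnx using 1 <;> ring
  · rw [← dvd_neg]
    convert hny using 1 <;> ring
end

section
/- Let O := ℚ[z,z⁻¹] be the ring of Laurent polynomials over ℚ, and let S be the multiplicative subset of O generated by the elements 1−z^n for all n ≥ 1. Set Φ_1 := z−1 and, for s ≥ 2, let Φ_s ∈ O be the s-th cyclotomic polynomial. Then each Φ_s becomes invertible in the localization S⁻¹O, and the canonical O-module homomorphism ⊕_{s≥1} (O[1/Φ_s]/O) → S⁻¹O/O, induced on each summand by the localization map O[1/Φ_s] → S⁻¹O, is an isomorphism of O-modules. -/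
set_option maxHeartbeats 4000000
set_option synthInstance.maxHeartbeats 400000

open LaurentPolynomial Polynomial

/-- `O = ℚ[z,z⁻¹]`, the ring of Laurent polynomials over `ℚ` (here `z = T 1`). -/
abbrev LQ : Type := LaurentPolynomial ℚ

/-- The multiplicative subset `S` of `O = ℚ[z,z⁻¹]` generated by the Euler classes
`1 − z^n` for `n ≥ 1`. -/
noncomputable def eulerSubmonoid : Submonoid LQ :=
  Submonoid.closure {x | ∃ n : ℕ, 1 ≤ n ∧ x = 1 - T (n : ℤ)}

/-- `Φ_s`: the image in `ℚ[z,z⁻¹]` of the `s`-th cyclotomic polynomial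
(so `Φ_1 = z − 1`). -/
noncomputable def cycLaurent (s : ℕ+) : LQ := toLaurent (cyclotomic s ℚ)

/-- `Φ_1 = z − 1`. -/
theorem cycLaurent_one : cycLaurent 1 = T 1 - 1 := by
  simp [cycLaurent, cyclotomic_one]

/-- Each `Φ_s` becomes invertible in `S⁻¹O`. -/
theorem cycLaurent_isUnit (s : ℕ+) :
    IsUnit (algebraMap LQ (Localization eulerSubmonoid) (cycLaurent s)) := by
  have hdvd : cycLaurent s ∣ T ((s : ℕ) : ℤ) - 1 := by
    have h := Polynomial.cyclotomic.dvd_X_pow_sub_one (s : ℕ) ℚ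
    have h2 := map_dvd (Polynomial.toLaurent (R := ℚ)) h
    simpa [cycLaurent, map_sub, Polynomial.toLaurent_X_pow] using h2
  have hunit : IsUnit (algebraMap LQ (Localization eulerSubmonoid) (T ((s : ℕ) : ℤ) - 1)) := by
    have hmem : (1 - T ((s : ℕ) : ℤ) : LQ) ∈ eulerSubmonoid :=
      Submonoid.subset_closure ⟨(s : ℕ), s.one_le, rfl⟩
    have hu := IsLocalization.map_units (M := eulerSubmonoid)
      (Localization eulerSubmonoid) ⟨_, hmem⟩
    have h2 : (T ((s : ℕ) : ℤ) - 1 : LQ) = -(1 - T ((s : ℕ) : ℤ)) := by ring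
    rw [h2, map_neg]
    exact hu.neg
  exact isUnit_of_dvd_unit (map_dvd _ hdvd) hunit

/-- The quotient `O[1/Φ_s]/O`. -/
abbrev CycCok (s : ℕ+) : Type :=
  Localization.Away (cycLaurent s) ⧸
    LinearMap.range (Algebra.linearMap LQ (Localization.Away (cycLaurent s)))

/-- The quotient `S⁻¹O/O`. -/
abbrev TotCok : Type :=
  Localization eulerSubmonoid ⧸
    LinearMap.range (Algebra.linearMap LQ (Localization eulerSubmonoid))

/-- The images of powers of `Φ_s` are invertible in `S⁻¹O`. -/
theorem cycLaurent_powers_isUnit (s : ℕ+) (y : Submonoid.powers (cycLaurent s)) :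
    IsUnit ((Algebra.ofId LQ (Localization eulerSubmonoid)) y) := by
  obtain ⟨n, hn⟩ := y.2
  simp only [Algebra.ofId_apply]
  rw [← hn, map_pow]
  exact (cycLaurent_isUnit s).pow n

/-- The canonical localization map `O[1/Φ_s] → S⁻¹O`, as an `O`-module map. -/
noncomputable def psiLin (s : ℕ+) :
    Localization.Away (cycLaurent s) →ₗ[LQ] Localization eulerSubmonoid :=
  (IsLocalization.liftAlgHom (M := Submonoid.powers (cycLaurent s))
    (f := Algebra.ofId LQ (Localization eulerSubmonoid))
    (cycLaurent_powers_isUnit s)).toLinearMap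

/-- The `O`-module map `O[1/Φ_s]/O → S⁻¹O/O` induced by the localization map. -/
noncomputable def cycCokToTot (s : ℕ+) : CycCok s →ₗ[LQ] TotCok :=
  Submodule.mapQ _ _ (psiLin s) (by
    intro x hx
    obtain ⟨a, rfl⟩ := hx
    refine ⟨a, ?_⟩
    simp only [Algebra.linearMap_apply]
    exact ((IsLocalization.liftAlgHom (M := Submonoid.powers (cycLaurent s))
      (f := Algebra.ofId LQ (Localization eulerSubmonoid))
      (cycLaurent_powers_isUnit s)).commutes a).symm)

/-- Partial fractions: if the `g i` have inverses `u i` in an algebra and are pairwise coprime, then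
any fraction with denominator `∏ g i` is a combination of `1` and the `u i`. -/
theorem exists_eq_add_sum_smul_inverse {R K ι : Type*} [CommRing R] [CommRing K] [Algebra R K]
    (t : Finset ι) (g : ι → R) (hg : Pairwise (Function.onFun IsCoprime g)) (u : ι → K)
    (hu : ∀ i, g i • u i = 1) (x : K) (a : R) (hx : (∏ i ∈ t, g i) • x = algebraMap R K a) :
    ∃ (c : R) (b : ι → R), x = algebraMap R K c + ∑ i ∈ t, b i • u i := by
  classical
  rcases t.eq_empty_or_nonempty with rfl | ht
  · exact ⟨a, 0, by simpa using hx⟩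
  obtain ⟨μ, hμ⟩ := (exists_sum_eq_one_iff_pairwise_coprime (s := g) ht).2
    fun i j hij => hg (Subtype.coe_injective.ne hij)
  refine ⟨0, fun i => μ i * a, ?_⟩
  rw [map_zero, zero_add]
  calc x = (∑ i ∈ t, μ i * ∏ j ∈ t \ {i}, g j) • x := by rw [hμ, one_smul]
    _ = ∑ i ∈ t, (μ i * a) • u i := by
      rw [Finset.sum_smul]
      refine Finset.sum_congr rfl fun i hi => ?_
      have hprod : ∏ j ∈ t, g j = g i * ∏ j ∈ t \ {i}, g j :=
        Finset.prod_eq_mul_prod_sdiff_singleton_of_mem hi g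
      have hi1 := hu i
      rw [hprod] at hx
      simp only [Algebra.smul_def, map_mul] at hx hi1 ⊢
      linear_combination (-algebraMap R K (μ i) * algebraMap R K (∏ j ∈ t \ {i}, g j) * x) * hi1
        + algebraMap R K (μ i) * u i * hx

/-- Uniqueness of partial fractions: if a sum of fractions `a i / g i` with pairwise coprime
denominators is integral, then each of the fractions is. -/
theorem dvd_of_sum_eq_algebraMap {R K ι : Type*} [CommRing R] [CommRing K] [Algebra R K]
    (hinj : Function.Injective (algebraMap R K)) (t : Finset ι) (g : ι → R)
    (hg : Pairwise (Function.onFun IsCoprime g)) (y : ι → K) (a : ι → R)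
    (hy : ∀ i, g i • y i = algebraMap R K (a i)) (c : R)
    (hc : ∑ i ∈ t, y i = algebraMap R K c) {i : ι} (hi : i ∈ t) : g i ∣ a i := by
  classical
  have hmem : (∏ j ∈ t.erase i, g j) • ∑ j ∈ t.erase i, y j ∈
      LinearMap.range (Algebra.linearMap R K) := by
    rw [Finset.smul_sum]
    refine Submodule.sum_mem _ fun j hj => ⟨(∏ k ∈ (t.erase i).erase j, g k) * a j, ?_⟩
    rw [← Finset.prod_erase_mul _ _ hj, mul_smul, hy, Algebra.linearMap_apply, map_mul,
      Algebra.smul_def]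
  obtain ⟨b, hb⟩ := hmem
  refine IsCoprime.dvd_of_dvd_mul_left (z := a i)
    (IsCoprime.prod_right (t := t.erase i) (s := g)
      fun j hj => hg (Finset.ne_of_mem_erase hj).symm)
    ⟨(∏ j ∈ t.erase i, g j) * c - b, hinj ?_⟩
  have hyi := hy i
  rw [← Finset.add_sum_erase _ _ hi] at hc
  simp only [Algebra.smul_def, Algebra.linearMap_apply, map_mul, map_sub] at hyi hb ⊢
  linear_combination -algebraMap R K (∏ j ∈ t.erase i, g j) * hyi
    + algebraMap R K (∏ j ∈ t.erase i, g j) * algebraMap R K (g i) * hc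
    + algebraMap R K (g i) * hb

theorem pairwise_isCoprime_cycLaurent_pow (n : ℕ+ → ℕ) :
    Pairwise (Function.onFun IsCoprime fun s => cycLaurent s ^ n s) := fun _ _ hij =>
  ((cyclotomic.isCoprime_rat (PNat.coe_injective.ne hij)).map
    (toLaurent (R := ℚ))).pow

/-- Every element of `S` divides a product of powers of the `Φ_s`. -/
theorem exists_dvd_prod_cycLaurent_pow {d : LQ} (hd : d ∈ eulerSubmonoid) :
    ∃ (t : Finset ℕ+) (N : ℕ), d ∣ ∏ s ∈ t, cycLaurent s ^ N := by
  classical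
  induction hd using Submonoid.closure_induction with
  | mem x hx =>
    obtain ⟨n, hn, rfl⟩ := hx
    refine ⟨n.divisors.image Nat.toPNat', 1, ?_⟩
    have hcoe : ∀ i ∈ n.divisors, ((Nat.toPNat' i : ℕ+) : ℕ) = i := fun i hi => by
      simp [Nat.toPNat'_coe, Nat.pos_of_mem_divisors hi]
    rw [Finset.prod_image fun i hi j hj hij => by rw [← hcoe i hi, hij, hcoe j hj]]
    have hprod : ∏ i ∈ n.divisors, cycLaurent (Nat.toPNat' i) ^ 1 = T (n : ℤ) - 1 := by
      rw [← toLaurent_X_pow, ← map_one (toLaurent (R := ℚ)), ← map_sub,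
        ← prod_cyclotomic_eq_X_pow_sub_one hn, map_prod]
      exact Finset.prod_congr rfl fun i hi => by rw [pow_one, cycLaurent, hcoe i hi]
    rw [hprod, ← neg_sub, neg_dvd]
  | one => exact ⟨∅, 0, one_dvd _⟩
  | mul x y _ _ hx hy =>
    obtain ⟨t, N, hx⟩ := hx
    obtain ⟨t', N', hy⟩ := hy
    refine ⟨t ∪ t', N + N', ?_⟩
    simp only [pow_add, Finset.prod_mul_distrib]
    exact mul_dvd_mul (hx.trans (Finset.prod_dvd_prod_of_subset _ _ _ Finset.subset_union_left))
      (hy.trans (Finset.prod_dvd_prod_of_subset _ _ _ Finset.subset_union_right))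

theorem eulerSubmonoid_le_nonZeroDivisors : eulerSubmonoid ≤ nonZeroDivisors LQ := by
  refine Submonoid.closure_le.2 ?_
  rintro _ ⟨n, hn, rfl⟩
  refine mem_nonZeroDivisors_of_ne_zero fun h => ?_
  have hne : (X ^ n - 1 : ℚ[X]) ≠ 0 := (monic_X_pow_sub_C (1 : ℚ) (by omega)).ne_zero
  refine hne (toLaurent_injective ?_)
  rw [map_sub, toLaurent_X_pow, map_one, map_zero, ← neg_sub, h, neg_zero]

theorem psiLin_algebraMap (s : ℕ+) (a : LQ) :
    psiLin s (algebraMap LQ _ a) = algebraMap LQ (Localization eulerSubmonoid) a :=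
  (IsLocalization.liftAlgHom (M := Submonoid.powers (cycLaurent s))
    (f := Algebra.ofId LQ (Localization eulerSubmonoid)) (cycLaurent_powers_isUnit s)).commutes a

theorem cycCokToTot_mk (s : ℕ+) (x : Localization.Away (cycLaurent s)) :
    cycCokToTot s (Submodule.Quotient.mk x) = Submodule.Quotient.mk (psiLin s x) :=
  rfl

theorem injective_toModule_cycCokToTot :
    Function.Injective (DirectSum.toModule LQ ℕ+ TotCok cycCokToTot) := by
  classical
  rw [injective_iff_map_eq_zero]
  intro v hv
  choose x hx using fun s => Submodule.Quotient.mk_surjective _ (v s)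
  choose n a hna using fun s => IsLocalization.Away.surj (cycLaurent s) (x s)
  have hsum : DirectSum.toModule LQ ℕ+ TotCok cycCokToTot v =
      Submodule.Quotient.mk (∑ s ∈ DFinsupp.support v, psiLin s (x s)) := by
    rw [← Submodule.mkQ_apply, map_sum]
    conv_lhs => rw [← DirectSum.sum_support_of v, map_sum]
    refine Finset.sum_congr rfl fun s _ => ?_
    rw [Submodule.mkQ_apply, ← cycCokToTot_mk, hx]
    exact DirectSum.toModule_lof LQ s (v s)
  rw [hsum, Submodule.Quotient.mk_eq_zero] at hv
  obtain ⟨c, hc⟩ := hv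
  refine DFinsupp.ext fun s => ?_
  by_contra hs
  obtain ⟨b, hb⟩ := dvd_of_sum_eq_algebraMap
    (IsLocalization.injective (Localization eulerSubmonoid) eulerSubmonoid_le_nonZeroDivisors)
    (DFinsupp.support v) (fun s => cycLaurent s ^ n s) (pairwise_isCoprime_cycLaurent_pow n)
    (fun s => psiLin s (x s)) a
    (fun s => by
      rw [← map_smul, ← psiLin_algebraMap s, ← hna, Algebra.smul_def, map_pow, mul_comm])
    c hc.symm (DFinsupp.mem_support_iff.2 hs)
  refine hs ((hx s).symm.trans ((Submodule.Quotient.mk_eq_zero _).2 ⟨b, ?_⟩))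
  have hunit := (IsLocalization.Away.algebraMap_isUnit (S := Localization.Away (cycLaurent s))
    (cycLaurent s)).pow (n s)
  refine hunit.mul_right_cancel ?_
  rw [hna, hb, Algebra.linearMap_apply, map_mul, map_pow, mul_comm]

theorem surjective_toModule_cycCokToTot :
    Function.Surjective (DirectSum.toModule LQ ℕ+ TotCok cycCokToTot) := by
  intro q
  obtain ⟨x, rfl⟩ := Submodule.Quotient.mk_surjective _ q
  obtain ⟨⟨a, d⟩, hd⟩ := IsLocalization.surj eulerSubmonoid x
  obtain ⟨t, N, e, he⟩ := exists_dvd_prod_cycLaurent_pow d.2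
  let u (s : ℕ+) : Localization.Away (cycLaurent s) :=
    IsLocalization.Away.invSelf (cycLaurent s) ^ N
  have hu (s : ℕ+) : cycLaurent s ^ N • psiLin s (u s) = 1 := by
    rw [← map_smul, Algebra.smul_def, map_pow, ← mul_pow, IsLocalization.Away.mul_invSelf,
      one_pow, ← map_one (algebraMap LQ _), psiLin_algebraMap, map_one]
  obtain ⟨c, b, hx⟩ := exists_eq_add_sum_smul_inverse t (fun s => cycLaurent s ^ N)
    (pairwise_isCoprime_cycLaurent_pow fun _ => N) (fun s => psiLin s (u s)) hu x (a * e) (by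
      rw [he, Algebra.smul_def, map_mul, map_mul, ← hd]
      ring)
  refine ⟨∑ s ∈ t, DirectSum.lof LQ ℕ+ CycCok s (Submodule.Quotient.mk (b s • u s)), ?_⟩
  rw [map_sum]
  simp only [DirectSum.toModule_lof, cycCokToTot_mk, map_smul]
  have hc : algebraMap LQ (Localization eulerSubmonoid) c ∈
      LinearMap.range (Algebra.linearMap LQ (Localization eulerSubmonoid)) := ⟨c, rfl⟩
  rw [← Submodule.mkQ_apply, hx, map_add, map_sum, Submodule.mkQ_apply,
    (Submodule.Quotient.mk_eq_zero _).2 hc, zero_add]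
  rfl

/-- Each `Φ_s` is invertible in `S⁻¹O`, and the canonical `O`-module map
`⊕_{s≥1} O[1/Φ_s]/O → S⁻¹O/O` induced by the localization maps is an isomorphism
of `O`-modules. -/
theorem directSum_cyclotomic_cokernels_iso :
    (∀ s : ℕ+, IsUnit (algebraMap LQ (Localization eulerSubmonoid) (cycLaurent s))) ∧
    Function.Bijective (DirectSum.toModule LQ ℕ+ TotCok cycCokToTot) :=
  ⟨cycLaurent_isUnit, injective_toModule_cycCokToTot, surjective_toModule_cycCokToTot⟩
end
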